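/- Let E be a field of characteristic 0, let n ≥ 2, and let T = E[u_i, v_{jk} : 1 ≤ i ≤ n, 1 ≤ j < k ≤ n] be a polynomial ring. Then the elements f_{ij} = u_i u_j - v_{ij}^2, for 1 ≤ i < j ≤ n, form a regular sequence in T. -/

import Mathlib

open MvPolynomial

/-- A monic polynomial over `R` is a nonzerodivisor modulo the extension of an ideal of `R`. -/
theorem Polynomial.Monic.mem_map_C_of_mul_mem {R : Type*} [CommRing R] {p g : Polynomial R}
    (hp : p.Monic) {J : Ideal R} (h : p * g ∈ J.map Polynomial.C) :
    g ∈ J.map Polynomial.C := by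
  rw [← Ideal.mk_ker (I := J), ← Polynomial.ker_mapRingHom, RingHom.mem_ker] at h ⊢
  rw [map_mul] at h
  exact (hp.map (Ideal.Quotient.mk J)).isRegular.left (h.trans (mul_zero _).symm)

namespace MvPolynomial

/-- Multivariate polynomials as univariate polynomials in the variable `s`, with coefficients
the polynomials in the other variables. -/
noncomputable def polynomialEquivNe (R : Type*) [CommRing R] {σ : Type*} [DecidableEq σ] (s : σ) :
    MvPolynomial σ R ≃ₐ[R] Polynomial (MvPolynomial {x // x ≠ s} R) :=
  (renameEquiv R (Equiv.optionSubtypeNe s).symm).trans (optionEquivLeft R _)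

section

variable {R : Type*} [CommRing R] {σ : Type*} [DecidableEq σ]

theorem polynomialEquivNe_X_self (s : σ) : polynomialEquivNe R s (X s) = Polynomial.X := by
  simp [polynomialEquivNe]

theorem polynomialEquivNe_X_of_ne {s t : σ} (h : t ≠ s) :
    polynomialEquivNe R s (X t) = Polynomial.C (X ⟨t, h⟩) := by
  simp [polynomialEquivNe, Equiv.optionSubtypeNe_symm_apply, h]

theorem polynomialEquivNe_rename {τ : Type*} {s : σ} (f : τ → σ) (hf : ∀ t, f t ≠ s)
    (p : MvPolynomial τ R) :
    polynomialEquivNe R s (rename f p) = Polynomial.C (rename (fun t ↦ ⟨f t, hf t⟩) p) := by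
  induction p using MvPolynomial.induction_on with
  | C r =>
    rw [rename_C, rename_C, ← algebraMap_eq, AlgEquiv.commutes]
    rfl
  | add p q hp hq => simp only [map_add, hp, hq]
  | mul_X p t hp => simp only [map_mul, hp, rename_X, polynomialEquivNe_X_of_ne (hf t)]

end

/-- For polynomials `a q` in the variables `σ`, the elements `a q - X q ^ 2`, for distinct
additional variables `q`, form a weakly regular sequence. -/
theorem isWeaklyRegular_map_sub_X_sq {R σ τ : Type*} [CommRing R] (a : τ → MvPolynomial σ R)
    {l : List τ} (hl : l.Nodup) :
    RingTheory.Sequence.IsWeaklyRegular (MvPolynomial (σ ⊕ τ) R)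
      (l.map fun q ↦ rename Sum.inl (a q) - X (Sum.inr q) ^ 2 : List (MvPolynomial (σ ⊕ τ) R)) := by
  classical
  refine ⟨fun i hi ↦ ?_⟩
  rw [List.length_map] at hi
  rw [isSMulRegular_quotient_iff_mem_of_smul_mem, List.getElem_map, ← List.map_take,
    smul_eq_mul, Ideal.mul_top]
  intro g hg
  have hq : l[i] ∉ l.take i := by
    intro h
    obtain ⟨j, hj, hji⟩ := List.mem_take_iff_getElem.mp h
    have := (hl.getElem_inj_iff).mp hji
    omega
  generalize l[i] = q at hg hq
  generalize l.take i = l' at hg hq ⊢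
  let e := polynomialEquivNe R (Sum.inr q : σ ⊕ τ)
  let b (p : τ) : MvPolynomial {x : σ ⊕ τ // x ≠ Sum.inr q} R :=
    rename (fun t ↦ ⟨Sum.inl t, Sum.inl_ne_inr⟩) (a p)
  have hb (p : τ) : e (rename Sum.inl (a p)) = Polynomial.C (b p) :=
    polynomialEquivNe_rename _ _ _
  obtain ⟨J, hJ⟩ : ∃ J : Ideal (MvPolynomial {x : σ ⊕ τ // x ≠ Sum.inr q} R),
      (Ideal.ofList (l'.map fun p ↦ rename Sum.inl (a p) - X (Sum.inr p) ^ 2)).map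
        (e : MvPolynomial (σ ⊕ τ) R →+* _) = J.map Polynomial.C := by
    refine ⟨Ideal.ofList (l'.attach.map fun p ↦ b p.1 - X ⟨Sum.inr p.1, fun h ↦
      hq (Sum.inr_injective h ▸ p.2)⟩ ^ 2), ?_⟩
    rw [Ideal.map_ofList, Ideal.map_ofList, List.map_map, List.map_map]
    refine congrArg _ (List.attach_map_val.symm.trans (List.map_congr_left fun p _ ↦ ?_))
    have hp : (Sum.inr p.1 : σ ⊕ τ) ≠ Sum.inr q := fun h ↦ hq (Sum.inr_injective h ▸ p.2)
    simp [hb, e, polynomialEquivNe_X_of_ne hp]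
  have mem_iff (x : MvPolynomial (σ ⊕ τ) R) :
      x ∈ Ideal.ofList (l'.map fun p ↦ rename Sum.inl (a p) - X (Sum.inr p) ^ 2) ↔
        e x ∈ J.map Polynomial.C := by
    rw [← hJ]
    exact ⟨Ideal.mem_map_of_mem _, fun h ↦ by
      obtain ⟨y, hy, hyx⟩ := (Ideal.mem_map_of_equiv e _).mp h
      exact e.injective hyx ▸ hy⟩
  rw [mem_iff] at hg ⊢
  have hm : (Polynomial.X ^ 2 - Polynomial.C (b q)).Monic :=
    Polynomial.monic_X_pow_sub_C _ two_ne_zero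
  refine hm.mem_map_C_of_mul_mem ?_
  rw [smul_eq_mul, map_mul, map_sub, hb, map_pow, polynomialEquivNe_X_self] at hg
  rw [← neg_sub, neg_mul]
  exact neg_mem hg

end MvPolynomial

/-- In the polynomial ring `T = E[u_i, v_{jk}]` (variables `u_1,…,u_n` and `v_{jk}` for
`j < k`), the elements `f_{ij} = u_i u_j - v_{ij}²` for `i < j`, listed in any order
without repetition, form a regular sequence. -/
theorem stmt4 (E : Type*) [Field E] [CharZero E] (n : ℕ) (hn : 2 ≤ n)
    (l : List {q : Fin n × Fin n // q.1 < q.2}) (hnd : l.Nodup)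
    (hall : ∀ q : {q : Fin n × Fin n // q.1 < q.2}, q ∈ l) :
    RingTheory.Sequence.IsRegular
      (R := MvPolynomial ((Fin n) ⊕ {q : Fin n × Fin n // q.1 < q.2}) E)
      (M := MvPolynomial ((Fin n) ⊕ {q : Fin n × Fin n // q.1 < q.2}) E)
      (l.map (fun q =>
        MvPolynomial.X (Sum.inl q.1.1) * MvPolynomial.X (Sum.inl q.1.2) -
          MvPolynomial.X (Sum.inr q) ^ 2)) := by
  refine ⟨?_, fun h ↦ ?_⟩
  · convert isWeaklyRegular_map_sub_X_sq
      (fun q : {q : Fin n × Fin n // q.1 < q.2} ↦ (X q.1.1 * X q.1.2 : MvPolynomial (Fin n) E)) hnd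
      using 4
    rw [map_mul, rename_X, rename_X]
  · rw [smul_eq_mul, Ideal.mul_top] at h
    have hle : Ideal.ofList (l.map fun q ↦ (X (Sum.inl q.1.1) * X (Sum.inl q.1.2) -
        X (Sum.inr q) ^ 2 : MvPolynomial (Fin n ⊕ {q : Fin n × Fin n // q.1 < q.2}) E)) ≤
        RingHom.ker constantCoeff := by
      refine Ideal.span_le.mpr fun x hx ↦ ?_
      obtain ⟨q, -, rfl⟩ := List.mem_map.mp hx
      simp [RingHom.mem_ker]
    exact RingHom.ker_ne_top constantCoeff (top_le_iff.mp (h ▸ hle))
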